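/- Let n be a positive integer, δ > 0, and r_i = i·δ for i = 1,...,n. Define d²_E(z) = Σ_{i=1}^n (r_i − (−1)^{z_i})² and the logistic weight w_L(z) = Σ_{i=1}^n z_i·i for z ∈ 𝔽₂ⁿ. If z, z' ∈ 𝔽₂ⁿ satisfy w_L(z) < w_L(z'), then d²_E(z) < d²_E(z'); that is, under the equidistant reliability model, error patterns with strictly smaller logistic weight are strictly closer to the received sequence in squared Euclidean distance. -/

import Mathlib

/-- The squared Euclidean distance is an affine function of the logistic weight. -/
lemma sum_sq_sub_sign_eq (n : ℕ) (δ : ℝ) (z : Fin n → ZMod 2) :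
    (∑ i : Fin n, ((i.1 + 1) * δ - (if z i = 0 then (1 : ℝ) else -1)) ^ 2)
      = (∑ i : Fin n, ((i.1 + 1) * δ - 1) ^ 2)
        + 4 * δ * ((∑ i : Fin n, if z i = 1 then (i.1 + 1) else 0 : ℕ) : ℝ) := by
  push_cast
  rw [Finset.mul_sum, ← Finset.sum_add_distrib]
  refine Finset.sum_congr rfl fun i _ => ?_
  have h : ∀ a : ZMod 2, a = 0 ∨ a = 1 := by decide
  rcases h (z i) with h | h
  · simp [h]
  · simp only [h, one_ne_zero, if_false, if_true]
    ring

/-- Under the equidistant reliability model `r i = i·δ`, error patterns with strictly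
smaller logistic weight are strictly closer to the received sequence in squared Euclidean
distance. -/
theorem stmt_2 (n : ℕ) (hn : 0 < n) (δ : ℝ) (hδ : 0 < δ)
    (z z' : Fin n → ZMod 2)
    (hw : (∑ i : Fin n, if z i = 1 then (i.1 + 1) else 0)
        < (∑ i : Fin n, if z' i = 1 then (i.1 + 1) else 0)) :
    (∑ i : Fin n, ((i.1 + 1) * δ - (if z i = 0 then (1 : ℝ) else -1)) ^ 2)
      < (∑ i : Fin n, ((i.1 + 1) * δ - (if z' i = 0 then (1 : ℝ) else -1)) ^ 2) := by
  rw [sum_sq_sub_sign_eq, sum_sq_sub_sign_eq]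
  gcongr
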